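/- arXiv:1804.11175 — 3 statements merged into one kernel-verified Lean document; each statement's English description precedes it below -/
import Mathlib

section
/- Let Σ be a finite alphabet and let x and y be nonempty words over Σ. The language L_{x=y} = {z ∈ Σ* : |z|_x = |z|_y} is regular if and only if x is interlaced by y or y is interlaced by x. -/
/-- Number of (possibly overlapping) occurrences of `x` as a contiguous
subword (factor) of `z`. -/
def occCount {α : Type*} [DecidableEq α] (x z : List α) : ℕ :=
  ((List.range (z.length + 1)).filter (fun i => decide (x <+: z.drop i))).length

/-- `wpow w n` is the word `w` concatenated with itself `n` times. -/
def wpow {α : Type*} (w : List α) (n : ℕ) : List α := (List.replicate n w).flatten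

/-- `z` is `y`-bordered: `z ≠ y` and `y` is both a prefix and a suffix of `z`. -/
def IsBordered {α : Type*} (y z : List α) : Prop := z ≠ y ∧ y <+: z ∧ y <:+ z

/-- `x` is interlaced by `y`: `y` is a subword (factor) of every `x`-bordered word. -/
def InterlacedBy {α : Type*} (x y : List α) : Prop :=
  ∀ z : List α, IsBordered x z → y <:+: z

section helpers
variable {α : Type} [DecidableEq α]

theorem occ_nil (x : List α) (hx : x ≠ []) : occCount x [] = 0 := by
  simp [occCount, hx]

theorem occ_cons (x : List α) (a : α) (w : List α) :
    occCount x (a :: w) = occCount x w + if x <+: a :: w then 1 else 0 := by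
  unfold occCount
  rw [List.length_cons, List.range_succ_eq_map (n := w.length + 1), List.filter_cons]
  have h : ((List.range (w.length + 1)).map Nat.succ).filter
      (fun i => decide (x <+: (a :: w).drop i)) =
      ((List.range (w.length + 1)).filter (fun i => decide (x <+: w.drop i))).map Nat.succ := by
    rw [List.filter_map]; rfl
  rw [h]
  by_cases hp : x <+: a :: w <;> simp [hp]

theorem occ_snoc (x : List α) (hx : x ≠ []) (w : List α) (a : α) :
    occCount x (w ++ [a]) = occCount x w + if x <:+ w ++ [a] then 1 else 0 := by
  induction w with
  | nil =>
    rw [List.nil_append, occ_cons, occ_nil x hx]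
    have : x <+: [a] ↔ x <:+ [a] := by
      rw [List.prefix_cons_iff, List.suffix_cons_iff]
      simp [hx]
    simp [this]
  | cons b w ih =>
    rw [List.cons_append, occ_cons, ih, occ_cons]
    by_cases he : x = b :: (w ++ [a])
    · have h1 : ¬ x <:+ w ++ [a] := fun h => by
        have := h.length_le; rw [he] at this; simp at this
      have h2 : ¬ x <+: b :: w := fun h => by
        have := h.length_le; rw [he] at this; simp at this
      rw [if_neg h1, if_neg h2, if_pos (he ▸ List.prefix_rfl), if_pos (he ▸ List.suffix_rfl)]
    · have h1 : x <:+ b :: (w ++ [a]) ↔ x <:+ w ++ [a] := by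
        rw [List.suffix_cons_iff]; simp [he]
      have h2 : x <+: b :: (w ++ [a]) ↔ x <+: b :: w := by
        rw [← List.cons_append, List.prefix_concat_iff]; simp [he]
      simp only [h1, h2]; omega

theorem occ_le_append (x u v : List α) : occCount x v ≤ occCount x (u ++ v) := by
  induction u with
  | nil => simp
  | cons a u ih => rw [List.cons_append, occ_cons]; omega

theorem occ_append_le (x u v : List α) : occCount x (u ++ v) ≤ u.length + occCount x v := by
  induction u with
  | nil => simp
  | cons a u ih =>
    rw [List.cons_append, occ_cons, List.length_cons]
    split_ifs <;> omega

theorem occ_le_length (x v : List α) (hx : x ≠ []) : occCount x v ≤ v.length := by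
  have := occ_append_le x v []
  rw [List.append_nil, occ_nil x hx] at this
  simpa using this

theorem occ_zero (x v : List α) (hx : x ≠ []) (h : ¬ x <:+: v) : occCount x v = 0 := by
  induction v with
  | nil => exact occ_nil x hx
  | cons a v ih =>
    rw [occ_cons, ih (fun h' => h (h'.trans (List.suffix_cons a v).isInfix)),
      if_neg (fun h' => h h'.isInfix)]

theorem occ_mono_prefix (x y z : List α) (hy : y ≠ []) (h : y <+: x) :
    occCount x z ≤ occCount y z := by
  have hx : x ≠ [] := fun h' => by subst h'; exact hy (List.prefix_nil.1 h)
  induction z with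
  | nil => simp [occ_nil, hx, hy]
  | cons a z ih =>
    rw [occ_cons, occ_cons]
    by_cases h1 : x <+: a :: z
    · simp [h1, h.trans h1, ih]
    · rw [if_neg h1]; omega

theorem occ_mono_suffix (x y z : List α) (hy : y ≠ []) (h : y <:+ x) :
    occCount x z ≤ occCount y z := by
  have hx : x ≠ [] := fun h' => by subst h'; exact hy (List.suffix_nil.1 h)
  induction z using List.reverseRecOn with
  | nil => simp [occ_nil, hx, hy]
  | append_singleton z a ih =>
    rw [occ_snoc x hx, occ_snoc y hy]
    by_cases h1 : x <:+ z ++ [a]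
    · simp [h1, h.trans h1, ih]
    · rw [if_neg h1]; omega

theorem occ_mono_infix (x y z : List α) (hy : y ≠ []) (h : y <:+: x) :
    occCount x z ≤ occCount y z := by
  obtain ⟨s, t, rfl⟩ := h
  refine le_trans (occ_mono_prefix _ (s ++ y) z (by simp [hy]) ⟨t, rfl⟩) ?_
  exact occ_mono_suffix _ y z hy ⟨s, rfl⟩

theorem occ_interlaced (x y : List α) (hx : x ≠ []) (hy : y ≠ []) (h : InterlacedBy x y)
    (z : List α) : occCount x z ≤ occCount y z + 1 := by
  by_cases hyx : y <:+: x
  · have := occ_mono_infix x y z hy hyx; omega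
  suffices H : occCount x z ≤ occCount y z + 1 ∧
      ∀ u : List α, u ≠ [] → x <+: u ++ z →
        (∀ u1 u2, u = u1 ++ u2 → u2 ≠ [] → ¬ y <+: u2 ++ z) → occCount x z ≤ occCount y z from H.1
  induction z with
  | nil => simp [occ_nil, hx]
  | cons a w ih =>
    obtain ⟨P, S⟩ := ih
    constructor
    · rw [occ_cons, occ_cons]
      by_cases h1 : x <+: a :: w
      · by_cases h2 : y <+: a :: w
        · rw [if_pos h1, if_pos h2]; omega
        · have := S [a] (by simp) h1 (by
            intro u1 u2 hu hu2
            have : u2 = [a] := by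
              have : u2 <:+ [a] := ⟨u1, hu.symm⟩
              rw [List.suffix_cons_iff] at this
              simpa [hu2] using this
            subst this
            exact h2)
          rw [if_pos h1, if_neg h2]; omega
      · rw [if_neg h1]; omega
    · intro u hu hxu hno
      have h1 : ¬ x <+: a :: w := by
        intro hp
        have hpre : x <+: u ++ x := by
          obtain ⟨t, ht⟩ := hp
          rw [← ht, ← List.append_assoc] at hxu
          exact List.prefix_of_prefix_length_le hxu (List.prefix_append _ _) (by simp)
        obtain ⟨s, t, hst⟩ := h (u ++ x) ⟨by simpa using hu, hpre, ⟨u, rfl⟩⟩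
        rw [List.append_assoc, List.append_eq_append_iff] at hst
        rcases hst with ⟨u2, hu2, he⟩ | ⟨c, hc, he⟩
        · by_cases hn : u2 = []
          · subst hn
            exact hyx ⟨[], t, by simpa using he⟩
          · refine hno s u2 hu2 hn ?_
            obtain ⟨r, hr⟩ := hp
            refine ⟨t ++ r, ?_⟩
            rw [← hr, ← List.append_assoc, he, List.append_assoc]
        · exact hyx ⟨c, t, by rw [List.append_assoc, ← he]⟩
      rw [occ_cons, occ_cons, if_neg h1]
      by_cases h2 : y <+: a :: w
      · rw [if_pos h2]; omega
      · have := S (u ++ [a]) (by simp) (by simpa using hxu) (by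
          intro u1 u2 he hne
          obtain ⟨u3, b, rfl⟩ := List.eq_nil_or_concat' u2 |>.resolve_left hne
          rw [← List.append_assoc] at he
          have he' := List.append_inj' he rfl
          have hb : a = b := by simpa using he'.2
          subst hb
          by_cases h3 : u3 = []
          · subst h3; simpa using h2
          · simpa using hno u1 u3 he'.1 h3)
        omega

theorem occ_split (x : List α) (hx : x ≠ []) (s t v : List α)
    (ht : s = [] ∨ x.length ≤ t.length) :
    occCount x (s ++ t ++ v) + occCount x t = occCount x (s ++ t) + occCount x (t ++ v) := by
  induction v using List.reverseRecOn with
  | nil => simp [Nat.add_comm]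
  | append_singleton v a ih =>
    rw [← List.append_assoc, ← List.append_assoc, occ_snoc x hx, occ_snoc x hx]
    have : x <:+ s ++ t ++ v ++ [a] ↔ x <:+ t ++ v ++ [a] := by
      rcases ht with rfl | ht
      · simp
      · constructor
        · intro h
          refine List.suffix_of_suffix_length_le h (by simp) ?_
          simp; omega
        · intro h
          exact h.trans ⟨s, by simp⟩
    simp only [this]; omega

theorem exists_balance (x y : List α) (hx : x ≠ []) (hy : y ≠ []) (v u : List α)
    (h1 : occCount y u ≤ occCount x u) (h2 : occCount x (u ++ v) ≤ occCount y (u ++ v)) :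
    ∃ v', occCount x (u ++ v') = occCount y (u ++ v') := by
  induction v generalizing u with
  | nil => exact ⟨[], by simp at h2 ⊢; omega⟩
  | cons a v ih =>
    by_cases he : occCount x u = occCount y u
    · exact ⟨[], by simpa using he⟩
    · obtain ⟨v', hv'⟩ := ih (u ++ [a]) (by
        rw [occ_snoc x hx, occ_snoc y hy]; split_ifs <;> omega) (by simpa using h2)
      exact ⟨a :: v', by simpa using hv'⟩

def runWord (p x : List α) : ℕ → List α
  | 0 => x
  | n + 1 => p ++ runWord p x n

theorem run_prefix (p x : List α) (h : x <+: p ++ x) (n : ℕ) : x <+: runWord p x n := by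
  induction n with
  | zero => exact List.prefix_rfl
  | succ n ih => exact h.trans ((List.prefix_append_right_inj p).2 ih)

theorem occ_step_y (p x y w : List α) (hyp : ¬ y <:+: p ++ x) (hxy : ¬ x <:+: y)
    (hw : x <+: w) : occCount y (p ++ w) = occCount y w := by
  induction p with
  | nil => rfl
  | cons a p ih =>
    rw [List.cons_append, occ_cons,
      ih (fun h => hyp (h.trans (List.suffix_cons a (p ++ x)).isInfix)), if_neg]
    · rfl
    · intro h
      have h' : (a :: p) ++ x <+: a :: (p ++ w) := by
        rw [← List.cons_append]; exact (List.prefix_append_right_inj _).2 hw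
      rcases List.prefix_or_prefix_of_prefix h h' with h3 | h3
      · exact hyp h3.isInfix
      · exact hxy ((List.suffix_append (a :: p) x).isInfix.trans h3.isInfix)

theorem occ_step_x (p x w : List α) (hp : p ≠ []) (h : x <+: p ++ x)
    (hw : x <+: w) : occCount x w + 1 ≤ occCount x (p ++ w) := by
  cases p with
  | nil => exact absurd rfl hp
  | cons a p =>
    rw [List.cons_append, occ_cons, if_pos]
    · have := occ_le_append x p w; omega
    · rw [← List.cons_append]
      exact h.trans ((List.prefix_append_right_inj _).2 hw)

theorem run_y (p x y v : List α) (h : x <+: p ++ x) (hyp : ¬ y <:+: p ++ x) (hxy : ¬ x <:+: y)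
    (n : ℕ) : occCount y (runWord p x n ++ v) = occCount y (x ++ v) := by
  induction n with
  | zero => rfl
  | succ n ih =>
    rw [runWord, List.append_assoc, occ_step_y p x y _ hyp hxy
      ((run_prefix p x h n).trans (List.prefix_append _ _)), ih]

theorem run_x (p x v : List α) (hp : p ≠ []) (h : x <+: p ++ x) :
    StrictMono (fun n => occCount x (runWord p x n ++ v)) := by
  refine strictMono_nat_of_lt_succ fun n => ?_
  have := occ_step_x p x (runWord p x n ++ v) hp h
    ((run_prefix p x h n).trans (List.prefix_append _ _))
  simp only [runWord, List.append_assoc]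
  omega

theorem not_interlaced (x y : List α) (h : ¬ InterlacedBy x y) :
    ∃ p, p ≠ [] ∧ x <+: p ++ x ∧ ¬ y <:+: p ++ x := by
  unfold InterlacedBy at h
  push Not at h
  obtain ⟨z, ⟨h1, h2, ⟨p, rfl⟩⟩, h3⟩ := h
  exact ⟨p, by rintro rfl; exact h1 rfl, h2, h3⟩

theorem not_regular (x y : List α) (hx : x ≠ []) (hy : y ≠ [])
    (h1 : ¬ InterlacedBy x y) (h2 : ¬ InterlacedBy y x) :
    ¬ Language.IsRegular ({z : List α | occCount x z = occCount y z} : Language α) := by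
  intro hreg
  obtain ⟨p, hp, hpx, hpy⟩ := not_interlaced x y h1
  obtain ⟨q, hq, hqy, hqx⟩ := not_interlaced y x h2
  have hyx : ¬ y <:+: x := fun h => hpy (h.trans (List.suffix_append p x).isInfix)
  have hxy : ¬ x <:+: y := fun h => hqx (h.trans (List.suffix_append q y).isInfix)
  have hfin := hreg.finite_range_leftQuotient
  have : ¬ Function.Injective (fun n : ℕ =>
      Language.leftQuotient ({z : List α | occCount x z = occCount y z} : Language α)
        (runWord p x n)) := by
    intro hinj
    refine Set.infinite_range_of_injective hinj (hfin.subset ?_)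
    rintro _ ⟨n, rfl⟩
    exact ⟨_, rfl⟩
  rw [Function.not_injective_iff] at this
  obtain ⟨n, m, he, hne⟩ := this
  have hbal : ∃ v, occCount x (runWord p x n ++ v) = occCount y (runWord p x n ++ v) := by
    refine exists_balance x y hx hy (runWord q y (runWord p x n).length) _ ?_ ?_
    · have := run_y p x y [] hpx hpy hxy n
      simp only [List.append_nil] at this
      rw [this, occ_zero y x hy hyx]; omega
    · have a1 := occ_append_le x (runWord p x n) (runWord q y (runWord p x n).length)
      have a2 := occ_le_append y (runWord p x n) (runWord q y (runWord p x n).length)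
      have a3 := run_y q y x [] hqy hqx hyx (runWord p x n).length
      have a4 := (run_x q y [] hq hqy).le_apply (x := (runWord p x n).length)
      simp only [List.append_nil] at a3 a4
      rw [occ_zero x y hx hxy] at a3
      omega
  obtain ⟨v, hv⟩ := hbal
  have hv1 : v ∈ Language.leftQuotient
      ({z : List α | occCount x z = occCount y z} : Language α) (runWord p x n) := hv
  have hv2 : v ∈ Language.leftQuotient
      ({z : List α | occCount x z = occCount y z} : Language α) (runWord p x m) := by
    simpa only [← he] using hv1
  have hv3 : occCount x (runWord p x m ++ v) = occCount y (runWord p x m ++ v) := hv2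
  rw [run_y p x y v hpx hpy hxy] at hv hv3
  exact hne ((run_x p x v hp hpx).injective (hv.trans hv3.symm))

theorem regular_of_interlaced [Finite α] (x y : List α) (hx : x ≠ []) (hy : y ≠ [])
    (h : InterlacedBy x y) :
    Language.IsRegular ({z : List α | occCount x z = occCount y z} : Language α) := by
  refine Language.isRegular_iff_finite_range_leftQuotient.2 ?_
  set N := x.length + y.length with hN
  let D : List α → ℤ := fun z => (occCount y z : ℤ) - occCount x z
  have hD : ∀ z, -1 ≤ D z := fun z => by
    have := occ_interlaced x y hx hy h z
    simp only [D]; omega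
  let F : List α × ℤ → Language α := fun q => {v | q.2 + D (q.1 ++ v) - D q.1 = 0}
  refine Set.Finite.subset
    (((List.finite_length_le α N).prod (Set.finite_Icc (-1 : ℤ) (N + 2))).image F) ?_
  rintro _ ⟨u, rfl⟩
  obtain ⟨s, t, rfl, htN, hst⟩ : ∃ s t : List α, u = s ++ t ∧ t.length ≤ N ∧
      (s = [] ∨ N ≤ t.length) := by
    refine ⟨u.take (u.length - N), u.drop (u.length - N), by simp, ?_, ?_⟩
    · simp; omega
    · rcases Nat.le_total u.length N with hle | hle
      · left; simp [Nat.sub_eq_zero_of_le hle]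
      · right; simp; omega
  refine ⟨(t, min (D (s ++ t)) (N + 2)), ⟨htN, ?_, ?_⟩, ?_⟩
  · exact le_min (hD _) (by omega)
  · exact min_le_right _ _
  · ext v
    have e1 := occ_split x hx s t v (hst.imp_right (by omega))
    have e2 := occ_split y hy s t v (hst.imp_right (by omega))
    have e3 := hD (t ++ v)
    have e4 := occ_le_length y t hy
    change min (D (s ++ t)) (N + 2) + D (t ++ v) - D t = 0 ↔
      occCount x (s ++ t ++ v) = occCount y (s ++ t ++ v)
    simp only [D] at *
    omega

end helpers

theorem stmt_7 {α : Type} [Fintype α] [DecidableEq α] (x y : List α)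
    (hx : x ≠ []) (hy : y ≠ []) :
    Language.IsRegular ({z : List α | occCount x z = occCount y z} : Language α) ↔
      InterlacedBy x y ∨ InterlacedBy y x := by
  constructor
  · intro h
    by_contra hn
    rw [not_or] at hn
    exact not_regular x y hx hy hn.1 hn.2 h
  · rintro (h | h)
    · exact regular_of_interlaced x y hx hy h
    · have := regular_of_interlaced y x hy hx h
      simpa only [eq_comm] using this
end

section
/- Let Σ = {0,1} and let x, y be words over Σ with x ∉ A. If x is a subword of yty for every word t of length 3, then x is a subword of y. -/
/-- Over `Σ = {0,1}` (encoded as `Bool` with `0 = false`, `1 = true`), the language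
`A = 01⁺ ∪ 10⁺ ∪ 0⁺1 ∪ 1⁺0`. -/
def memA (x : List Bool) : Prop :=
  ∃ i : ℕ, 1 ≤ i ∧
    (x = false :: List.replicate i true ∨ x = true :: List.replicate i false ∨
     x = List.replicate i false ++ [true] ∨ x = List.replicate i true ++ [false])

/-- Window system: `D a b c` is the offset in `x` of the block `t = abc`. -/
structure WSys (X : ℤ → Bool) (m : ℤ) (D : Bool → Bool → Bool → ℤ) : Prop where
  lo : ∀ a b c, -2 ≤ D a b c
  hi : ∀ a b c, D a b c ≤ m - 1
  w0 : ∀ a b c, 0 ≤ D a b c → D a b c < m → X (D a b c) = a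
  w1 : ∀ a b c, 0 ≤ D a b c + 1 → D a b c + 1 < m → X (D a b c + 1) = b
  w2 : ∀ a b c, 0 ≤ D a b c + 2 → D a b c + 2 < m → X (D a b c + 2) = c
  per : ∀ a b c a' b' c' i j, D a b c ≤ D a' b' c' → 0 ≤ i → j = i + (D a' b' c' - D a b c) →
    j < m → (i < D a b c ∨ D a b c + 3 ≤ i) → X i = X j

theorem WSys.rev {X : ℤ → Bool} {m : ℤ} {D : Bool → Bool → Bool → ℤ} (h : WSys X m D) :
    WSys (fun i => X (m - 1 - i)) m (fun a b c => m - 3 - D c b a) where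
  lo a b c := by have := h.hi c b a; omega
  hi a b c := by have := h.lo c b a; omega
  w0 a b c h1 h2 := by
    have := h.w2 c b a (by omega) (by omega)
    refine Eq.trans (congrArg X ?_) this; ring
  w1 a b c h1 h2 := by
    have := h.w1 c b a (by omega) (by omega)
    refine Eq.trans (congrArg X ?_) this; ring
  w2 a b c h1 h2 := by
    have := h.w0 c b a (by omega) (by omega)
    refine Eq.trans (congrArg X ?_) this; ring
  per a b c a' b' c' i j h1 h2 h3 h4 h5 := by
    exact (h.per c' b' a' c b a (m - 1 - j) (m - 1 - i) (by omega) (by omega) (by omega)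
      (by omega) (by omega)).symm

/-- a nonempty system is not constant -/
theorem WSys.nonconst {X : ℤ → Bool} {m : ℤ} {D : Bool → Bool → Bool → ℤ} (h : WSys X m D)
    (hm : 1 ≤ m) (e : Bool) (hc : ∀ i, 0 ≤ i → i < m → X i = e) : False := by
  have h0 := h.lo (!e) (!e) (!e)
  have h1 := h.hi (!e) (!e) (!e)
  have a0 := h.w0 (!e) (!e) (!e)
  have a1 := h.w1 (!e) (!e) (!e)
  have a2 := h.w2 (!e) (!e) (!e)
  by_cases c0 : 0 ≤ D (!e) (!e) (!e)
  · have := a0 c0 (by omega)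
    rw [hc _ c0 (by omega)] at this; simp at this
  by_cases c1 : 0 ≤ D (!e) (!e) (!e) + 1
  · have := a1 c1 (by omega)
    rw [hc _ c1 (by omega)] at this; simp at this
  · have := a2 (by omega) (by omega)
    rw [hc _ (by omega) (by omega)] at this; simp at this

def ALeft (X : ℤ → Bool) (m : ℤ) : Prop := ∀ i, 1 ≤ i → i < m → X i = X 1
def ARight (X : ℤ → Bool) (m : ℤ) : Prop := ∀ i, 0 ≤ i → i < m - 1 → X i = X 0

theorem const_run (X : ℤ → Bool) (u v : ℤ) (hs : ∀ i, u ≤ i → i + 1 < v → X i = X (i + 1)) :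
    ∀ i, u ≤ i → i < v → X i = X u := by
  intro i hi
  induction i, hi using Int.leInduction with
  | base => intro _; rfl
  | succ n hn ih =>
    intro hv
    rw [← hs n hn hv]
    exact ih (by omega)

/-- Mid lemma -/
theorem WSys.mid {X : ℤ → Bool} {m : ℤ} {D : Bool → Bool → Bool → ℤ} (h : WSys X m D)
    (a b c a' b' c' a'' b'' c'' : Bool) (h0 : -1 ≤ D a b c) (h1 : D a b c + 2 ≤ D a' b' c')
    (h2 : D a' b' c' + 2 ≤ D a'' b'' c'') (h3 : D a'' b'' c'' ≤ m - 2) : b = b'' := by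
  have e1 := h.per a' b' c' a'' b'' c'' (D a b c + 1)
    (D a b c + 1 + (D a'' b'' c'' - D a' b' c')) (by omega) (by omega) rfl (by omega) (by omega)
  have e2 := h.per a b c a' b' c' (D a b c + 1 + (D a'' b'' c'' - D a' b' c'))
    (D a'' b'' c'' + 1) (by omega) (by omega) (by omega) (by omega) (by omega)
  rw [← h.w1 a b c (by omega) (by omega), ← h.w1 a'' b'' c'' (by omega) (by omega), e1, e2]

theorem WSys.noFour {X : ℤ → Bool} {m : ℤ} {D : Bool → Bool → Bool → ℤ} (h : WSys X m D)
    (gap : ∀ a b c a' b' c', D a' b' c' ≠ D a b c + 1)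
    (a c a' c' p r p' r' : Bool)
    (h1 : -1 ≤ D a false c ∧ D a false c ≤ m - 2) (h2 : -1 ≤ D a' false c' ∧ D a' false c' ≤ m - 2)
    (h3 : -1 ≤ D p true r ∧ D p true r ≤ m - 2) (h4 : -1 ≤ D p' true r' ∧ D p' true r' ≤ m - 2)
    (n1 : D a false c ≠ D a' false c') (n2 : D p true r ≠ D p' true r') : False := by
  have key : ∀ a c p r, -1 ≤ D a false c ∧ D a false c ≤ m - 2 →
      -1 ≤ D p true r ∧ D p true r ≤ m - 2 → D a false c ≠ D p true r := by
    intro a c p r u v e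
    have e1 := h.w1 a false c (by omega) (by omega)
    have e2 := h.w1 p true r (by omega) (by omega)
    rw [e, e2] at e1
    simp at e1
  have M : ∀ a b c a' b' c' a'' b'' c'', b ≠ b'' → ¬ (-1 ≤ D a b c ∧ D a b c + 2 ≤ D a' b' c' ∧
      D a' b' c' + 2 ≤ D a'' b'' c'' ∧ D a'' b'' c'' ≤ m - 2) := by
    intro a b c a' b' c' a'' b'' c'' hb ⟨q1, q2, q3, q4⟩
    exact hb (h.mid a b c a' b' c' a'' b'' c'' q1 q2 q3 q4)
  have gap' : ∀ a b c a' b' c', D a b c < D a' b' c' → D a b c + 2 ≤ D a' b' c' := by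
    intro a b c a' b' c' hl
    have := gap a b c a' b' c'
    omega
  have k1 := key _ _ _ _ h1 h3
  have k2 := key _ _ _ _ h1 h4
  have k3 := key _ _ _ _ h2 h3
  have k4 := key _ _ _ _ h2 h4
  -- sorted version
  have core : ∀ a c a' c' p r p' r', (-1 ≤ D a false c ∧ D a false c ≤ m - 2) →
      (-1 ≤ D a' false c' ∧ D a' false c' ≤ m - 2) →
      (-1 ≤ D p true r ∧ D p true r ≤ m - 2) → (-1 ≤ D p' true r' ∧ D p' true r' ≤ m - 2) →
      D a false c < D a' false c' → D p true r < D p' true r' → False := by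
    intro a c a' c' p r p' r' h1 h2 h3 h4 l1 l2
    have k1 := key _ _ _ _ h1 h3
    have k2 := key _ _ _ _ h1 h4
    have k3 := key _ _ _ _ h2 h3
    have k4 := key _ _ _ _ h2 h4
    have g1 := gap' _ _ _ _ _ _ l1
    have g2 := gap' _ _ _ _ _ _ l2
    have m1 := M a false c a' false c' p' true r' (by simp)
    have m2 := M p true r p' true r' a' false c' (by simp)
    have m3 := M a false c p true r p' true r' (by simp)
    have m4 := M p true r a false c a' false c' (by simp)
    have u1 := gap' a false c p true r
    have u2 := gap' a false c p' true r'
    have u3 := gap' a' false c' p true r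
    have u4 := gap' a' false c' p' true r'
    have v1 := gap' p true r a false c
    have v2 := gap' p true r a' false c'
    have v3 := gap' p' true r' a false c
    have v4 := gap' p' true r' a' false c'
    omega
  rcases lt_or_gt_of_ne n1 with l1 | l1 <;> rcases lt_or_gt_of_ne n2 with l2 | l2
  · exact core _ _ _ _ _ _ _ _ h1 h2 h3 h4 l1 l2
  · exact core _ _ _ _ _ _ _ _ h1 h2 h4 h3 l1 l2
  · exact core _ _ _ _ _ _ _ _ h2 h1 h3 h4 l1 l2
  · exact core _ _ _ _ _ _ _ _ h2 h1 h4 h3 l1 l2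

theorem WSys.oneSide {X : ℤ → Bool} {m : ℤ} {D : Bool → Bool → Bool → ℤ} (h : WSys X m D)
    (hm : 2 ≤ m)
    (gap : ∀ a b c a' b' c', D a' b' c' ≠ D a b c + 1)
    (hL : ∃ a b c, D a b c = -2) (hR : ∀ a b c, D a b c ≠ m - 1) : False := by
  obtain ⟨a, b, c, hd⟩ := hL
  have rng : ∀ p q, 0 ≤ D p q (!X 0) ∧ D p q (!X 0) ≤ m - 2 := by
    intro p q
    have h1 := h.lo p q (!X 0)
    have h2 := h.hi p q (!X 0)
    have h3 := hR p q (!X 0)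
    have h4 := gap a b c p q (!X 0)
    have h5 : D p q (!X 0) ≠ -2 := by
      intro e
      have := h.w2 p q (!X 0) (by omega) (by omega)
      rw [e] at this
      simp at this
    omega
  have ne : ∀ q, D false q (!X 0) ≠ D true q (!X 0) := by
    intro q e
    have r1 := rng false q
    have r2 := rng true q
    have e1 := h.w0 false q (!X 0) (by omega) (by omega)
    have e2 := h.w0 true q (!X 0) (by omega) (by omega)
    rw [e, e2] at e1
    simp at e1
  have r1 := rng false false
  have r2 := rng true false
  have r3 := rng false true
  have r4 := rng true true
  exact h.noFour gap _ _ _ _ _ _ _ _ (by omega) (by omega) (by omega) (by omega)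
    (ne false) (ne true)

theorem WSys.noGap {X : ℤ → Bool} {m : ℤ} {D : Bool → Bool → Bool → ℤ} (h : WSys X m D)
    (hm : 2 ≤ m)
    (gap : ∀ a b c a' b' c', D a' b' c' ≠ D a b c + 1) : False := by
  by_cases hL : ∃ a b c, D a b c = -2
  · by_cases hR : ∃ a b c, D a b c = m - 1
    · obtain ⟨a, b, c, hd⟩ := hL
      obtain ⟨a', b', c', hd'⟩ := hR
      have rng : ∀ q, 0 ≤ D (!X (m - 1)) q (!X 0) ∧ D (!X (m - 1)) q (!X 0) ≤ m - 3 := by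
        intro q
        have h1 := h.lo (!X (m - 1)) q (!X 0)
        have h2 := h.hi (!X (m - 1)) q (!X 0)
        have h3 := gap (!X (m - 1)) q (!X 0) a' b' c'
        have h4 := gap a b c (!X (m - 1)) q (!X 0)
        have h5 : D (!X (m - 1)) q (!X 0) ≠ -2 := by
          intro e
          have := h.w2 (!X (m - 1)) q (!X 0) (by omega) (by omega)
          rw [e] at this
          simp at this
        have h6 : D (!X (m - 1)) q (!X 0) ≠ m - 1 := by
          intro e
          have := h.w0 (!X (m - 1)) q (!X 0) (by omega) (by omega)
          rw [e] at this
          simp at this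
        omega
      have core : ∀ q q', D (!X (m - 1)) q (!X 0) < D (!X (m - 1)) q' (!X 0) → False := by
        intro q q' hl
        have r1 := rng q
        have r2 := rng q'
        set d := D (!X (m - 1)) q (!X 0) with hdd
        set d' := D (!X (m - 1)) q' (!X 0) with hdd'
        have e1 : X 0 = X (d' - d) := by
          by_cases h0 : d = 0
          · have f1 := h.w0 (!X (m - 1)) q (!X 0) (by omega) (by omega)
            have f2 := h.w0 (!X (m - 1)) q' (!X 0) (by omega) (by omega)
            rw [← hdd, h0] at f1
            rw [← hdd'] at f2
            rw [h0, sub_zero, f2, f1]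
          · exact h.per (!X (m - 1)) q (!X 0) (!X (m - 1)) q' (!X 0) 0 (d' - d) (by omega)
              (by omega) (by omega) (by omega) (by omega)
        have e2 := h.per a b c (!X (m - 1)) q (!X 0) (d' - d) (d' + 2) (by omega) (by omega)
          (by omega) (by omega) (by omega)
        have e3 := h.w2 (!X (m - 1)) q' (!X 0) (by omega) (by omega)
        rw [← hdd', ← e2, ← e1] at e3
        simp at e3
      have ne : D (!X (m - 1)) false (!X 0) ≠ D (!X (m - 1)) true (!X 0) := by
        intro e
        have r1 := rng false
        have r2 := rng true
        have e1 := h.w1 (!X (m - 1)) false (!X 0) (by omega) (by omega)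
        have e2 := h.w1 (!X (m - 1)) true (!X 0) (by omega) (by omega)
        rw [e, e2] at e1
        simp at e1
      rcases lt_or_gt_of_ne ne with l | l
      · exact core _ _ l
      · exact core _ _ l
    · push Not at hR
      exact h.oneSide hm gap hL hR
  · push Not at hL
    by_cases hR : ∃ a b c, D a b c = m - 1
    · obtain ⟨a', b', c', hd'⟩ := hR
      refine h.rev.oneSide hm ?_ ⟨c', b', a', by omega⟩ ?_
      · intro a b c a' b' c'
        have := gap c' b' a' c b a
        omega
      · intro a b c
        have := hL c b a
        omega
    · push Not at hR
      have rng : ∀ a b c, -1 ≤ D a b c ∧ D a b c ≤ m - 2 := by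
        intro a b c
        have h1 := h.lo a b c
        have h2 := h.hi a b c
        have h3 := hL a b c
        have h4 := hR a b c
        omega
      have ne : ∀ q, D false q false ≠ D true q true := by
        intro q e
        have r1 := rng false q false
        have r2 := rng true q true
        by_cases h0 : 0 ≤ D true q true
        · have e1 := h.w0 false q false (by omega) (by omega)
          have e2 := h.w0 true q true (by omega) (by omega)
          rw [e, e2] at e1
          simp at e1
        · have e1 := h.w2 false q false (by omega) (by omega)
          have e2 := h.w2 true q true (by omega) (by omega)
          rw [e, e2] at e1
          simp at e1
      exact h.noFour gap _ _ _ _ _ _ _ _ (rng _ _ _) (rng _ _ _) (rng _ _ _) (rng _ _ _)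
        (ne false) (ne true)

theorem WSys.gap0 {X : ℤ → Bool} {m : ℤ} {D : Bool → Bool → Bool → ℤ} (h : WSys X m D)
    (a b c : Bool) (hd : D a b c = -1) (hm : 2 ≤ m)
    (hX : ∀ i, 2 ≤ i → i < m → X i = !X 0) : ALeft X m ∨ ARight X m := by
  by_cases h1 : X 1 = X 0
  · by_cases h3 : m ≤ 3
    · right
      intro i hi hi'
      have : i = 0 ∨ i = 1 := by omega
      rcases this with rfl | rfl
      · rfl
      · exact h1
    · exfalso
      have x2 := hX 2 (by omega) (by omega)
      generalize hv : X 0 = v at *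
      have hl := h.lo v (!v) v
      have hh := h.hi v (!v) v
      have w0 := h.w0 v (!v) v
      have w1 := h.w1 v (!v) v
      have w2 := h.w2 v (!v) v
      have pr := h.per v (!v) v a b c 1 2
      have q0 := hX (D v (!v) v)
      have q1 := hX (D v (!v) v + 1)
      have q2 := hX (D v (!v) v + 2)
      generalize D v (!v) v = g at *
      have : g = -2 ∨ g = -1 ∨ g = 0 ∨ g = 1 ∨ 2 ≤ g := by omega
      rcases this with rfl | rfl | rfl | rfl | h2
      · have := pr (by omega) (by omega) (by omega) (by omega) (by omega)
        rw [h1, x2] at this; simp at this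
      · have := w1 (by omega) (by omega)
        norm_num [hv] at this
      · have := w1 (by omega) (by omega)
        norm_num [h1] at this
      · have := w2 (by omega) (by omega)
        have := q2 (by omega) (by omega)
        simp_all
      · have := w0 (by omega) (by omega)
        have := q0 (by omega) (by omega)
        simp_all
  · left
    intro i hi hi'
    rcases eq_or_lt_of_le hi with rfl | h2
    · rfl
    · rw [hX i (by omega) hi']
      revert h1; cases X 0 <;> cases X 1 <;> simp

theorem WSys.gapMid {X : ℤ → Bool} {m : ℤ} {D : Bool → Bool → Bool → ℤ} (h : WSys X m D)
    (a b c a' b' c' : Bool) (p : ℤ) (hd : D a b c = p - 1) (hd' : D a' b' c' = p) (hp : 1 ≤ p)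
    (hk : p + 3 ≤ m) (v : Bool) (hL : ∀ i, 0 ≤ i → i < p → X i = v)
    (hR : ∀ i, p + 2 ≤ i → i < m → X i = !v) : ALeft X m ∨ ARight X m := by
  -- shift facts
  have right : ∀ r s t i, p ≤ D r s t → 0 ≤ i → i < p → i + (D r s t - p) < m →
      X i = X (i + (D r s t - p)) := by
    intro r s t i h1 h2 h3 h4
    exact h.per a' b' c' r s t i _ (by omega) h2 (by omega) h4 (by omega)
  have left : ∀ r s t i, D r s t ≤ p - 1 → 0 ≤ i → D r s t + 3 ≤ i →
      i + (p - 1 - D r s t) < m → X i = X (i + (p - 1 - D r s t)) := by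
    intro r s t i h1 h2 h3 h4
    exact h.per r s t a b c i _ (by omega) h2 (by omega) h4 (by omega)
  have l0 := hL 0 (by omega) (by omega)
  have l1 := hL (p - 1) (by omega) (by omega)
  have r0 := hR (m - 1) (by omega) (by omega)
  have r1 := hR (p + 2) (by omega) (by omega)
  have full : ∀ i, 0 ≤ i → i < m →
      X i = if i < p then v else if i = p then X p else if i = p + 1 then X (p + 1) else !v := by
    intro i h0 h1
    split_ifs with c1 c2 c3
    · exact hL i h0 c1
    · rw [c2]
    · rw [c3]
    · exact hR i (by omega) h1
  have vn : ∀ w : Bool, w = v ∨ w = !v := by intro w; cases w <;> cases v <;> simp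
  have nv : v ≠ !v := by cases v <;> simp
  rcases vn (X p) with hb | hb <;> rcases vn (X (p + 1)) with hc | hc
  · by_cases hk1 : m = p + 3
    · right
      intro i h0 h1
      rw [l0, full i h0 (by omega)]
      split_ifs <;> first | rfl | assumption | omega
    · exfalso
      have hl := h.lo (!v) v (!v)
      have hh := h.hi (!v) v (!v)
      have w0 := h.w0 (!v) v (!v)
      have w1 := h.w1 (!v) v (!v)
      have w2 := h.w2 (!v) v (!v)
      have pr := right (!v) v (!v) (p - 1)
      generalize D (!v) v (!v) = g at *
      have f0 := full g
      have f1 := full (g + 1)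
      have f2 := full (g + 2)
      have f3 := full (p - 1 + (g - p))
      grind
  · exfalso
    have hl := h.lo (!v) v (!v)
    have hh := h.hi (!v) v (!v)
    have w0 := h.w0 (!v) v (!v)
    have w1 := h.w1 (!v) v (!v)
    have w2 := h.w2 (!v) v (!v)
    have pr := right (!v) v (!v) (p - 1)
    generalize D (!v) v (!v) = g at *
    have f0 := full g
    have f1 := full (g + 1)
    have f2 := full (g + 2)
    have f3 := full (p - 1 + (g - p))
    grind
  · exfalso
    by_cases hp2 : 2 ≤ p
    · have hl := h.lo (!v) (!v) (!v)
      have hh := h.hi (!v) (!v) (!v)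
      have w0 := h.w0 (!v) (!v) (!v)
      have w1 := h.w1 (!v) (!v) (!v)
      have w2 := h.w2 (!v) (!v) (!v)
      have pr := right (!v) (!v) (!v) (p - 1)
      have pr2 := right (!v) (!v) (!v) (p - 2)
      generalize D (!v) (!v) (!v) = g at *
      have f0 := full g
      have f1 := full (g + 1)
      have f2 := full (g + 2)
      have f3 := full (p - 1 + (g - p))
      have f4 := full (p - 2 + (g - p))
      have f5 := full (p - 2)
      grind
    by_cases hk2 : p + 4 ≤ m
    · have hl := h.lo v v v
      have hh := h.hi v v v
      have w0 := h.w0 v v v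
      have w1 := h.w1 v v v
      have w2 := h.w2 v v v
      have pr := left v v v (D v v v + 3)
      have pr2 := left v v v (D v v v + 4)
      generalize D v v v = g at *
      have f0 := full g
      have f1 := full (g + 1)
      have f2 := full (g + 2)
      have f3 := full (g + 3)
      have f4 := full (g + 4)
      have e1 : g + 3 + (p - 1 - g) = p + 2 := by ring
      have e2 : g + 4 + (p - 1 - g) = p + 3 := by ring
      have f5 := full (p + 3)
      grind
    · have hl := h.lo v (!v) (!v)
      have hh := h.hi v (!v) (!v)
      have w0 := h.w0 v (!v) (!v)
      have w1 := h.w1 v (!v) (!v)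
      have w2 := h.w2 v (!v) (!v)
      have pr := right v (!v) (!v) (p - 1)
      generalize D v (!v) (!v) = g at *
      have f0 := full g
      have f1 := full (g + 1)
      have f2 := full (g + 2)
      have f3 := full (p - 1 + (g - p))
      grind
  · by_cases hp1 : p = 1
    · left
      intro i h0 h1
      rw [full i (by omega) h1, full 1 (by omega) (by omega)]
      subst hp1
      simp only [hb]
      split_ifs <;> first | rfl | assumption | omega
    · exfalso
      have hl := h.lo v (!v) v
      have hh := h.hi v (!v) v
      have w0 := h.w0 v (!v) v
      have w1 := h.w1 v (!v) v
      have w2 := h.w2 v (!v) v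
      have pr := left v (!v) v (D v (!v) v + 3)
      generalize D v (!v) v = g at *
      have e1 : g + 3 + (p - 1 - g) = p + 2 := by ring
      have f0 := full g
      have f1 := full (g + 1)
      have f2 := full (g + 2)
      have f3 := full (g + 3)
      grind

theorem WSys.gap {X : ℤ → Bool} {m : ℤ} {D : Bool → Bool → Bool → ℤ} (h : WSys X m D)
    (hm : 2 ≤ m) (a b c a' b' c' : Bool) (hd : D a' b' c' = D a b c + 1) :
    ALeft X m ∨ ARight X m := by
  have hl := h.lo a b c
  have hh := h.hi a' b' c'
  have step : ∀ i, 0 ≤ i → i + 1 < m → (i < D a b c ∨ D a b c + 3 ≤ i) → X i = X (i + 1) := by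
    intro i h0 h1 h2
    exact h.per a b c a' b' c' i _ (by omega) h0 (by omega) h1 h2
  by_cases c1 : D a b c = -2
  · left
    exact const_run X 1 m (fun i h0 h1 => step i (by omega) h1 (by omega))
  by_cases c2 : D a b c = m - 2
  · right
    exact const_run X 0 (m - 1) (fun i h0 h1 => step i (by omega) (by omega) (by omega))
  obtain ⟨p, hp⟩ : ∃ p, p = D a b c + 1 := ⟨_, rfl⟩
  have L := const_run X 0 p (fun i h0 h1 => step i (by omega) (by omega) (by omega))
  have R : ∀ i, p + 2 ≤ i → i < m → X i = X (m - 1) := by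
    have R0 := const_run X (p + 2) m (fun i h0 h1 => step i (by omega) h1 (by omega))
    intro i h0 h1
    rw [R0 i h0 h1, R0 (m - 1) (by omega) (by omega)]
  by_cases he : X (m - 1) = X 0
  · exfalso
    generalize hv : X 0 = v at *
    have hl := h.lo (!v) (!v) (!v)
    have hh := h.hi (!v) (!v) (!v)
    have w0 := h.w0 (!v) (!v) (!v)
    have w1 := h.w1 (!v) (!v) (!v)
    have w2 := h.w2 (!v) (!v) (!v)
    generalize D (!v) (!v) (!v) = g at *
    have nv : v ≠ !v := by cases v <;> simp
    have L0 := L g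
    have L1 := L (g + 1)
    have L2 := L (g + 2)
    have R0 := R g
    have R1 := R (g + 1)
    have R2 := R (g + 2)
    grind
  have he' : X (m - 1) = !X 0 := by
    revert he; cases X 0 <;> cases X (m - 1) <;> simp
  by_cases hp0 : p = 0
  · exact h.gap0 a b c (by omega) hm (fun i h0 h1 => by rw [← he']; exact R i (by omega) h1)
  by_cases hk0 : p + 2 = m
  · have := h.rev.gap0 c' b' a' (by omega) hm (by
      intro i h0 h1
      simp only [sub_zero, he', Bool.not_not]
      exact L _ (by omega) (by omega))
    rcases this with h1 | h1
    · right
      intro i h2 h3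
      have e1 := h1 (m - 1 - i) (by omega) (by omega)
      have e2 := h1 (m - 1) (by omega) (by omega)
      simp only [sub_sub_cancel, sub_self] at e1 e2
      rw [e1, e2]
    · left
      intro i h2 h3
      have e1 := h1 (m - 1 - i) (by omega) (by omega)
      have e2 := h1 (m - 1 - 1) (by omega) (by omega)
      simp only [sub_sub_cancel] at e1 e2
      rw [e1, e2]
  · exact h.gapMid a b c a' b' c' p (by omega) (by omega) (by omega) (by omega) (X 0) L
      (fun i h0 h1 => by rw [R i h0 h1, he'])

theorem WSys.main {X : ℤ → Bool} {m : ℤ} {D : Bool → Bool → Bool → ℤ} (h : WSys X m D)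
    (hm : 1 ≤ m) : 2 ≤ m ∧ ((ALeft X m ∧ X 1 = !X 0) ∨ (ARight X m ∧ X (m - 1) = !X 0)) := by
  have h2 : 2 ≤ m := by
    by_contra hlt
    refine h.nonconst hm (X 0) ?_
    intro i h0 h1
    have : i = 0 := by omega
    rw [this]
  refine ⟨h2, ?_⟩
  have key : ALeft X m ∨ ARight X m := by
    by_contra hno
    refine h.noGap h2 ?_
    intro a b c a' b' c' hd
    exact hno (h.gap h2 a b c a' b' c' hd)
  have nb : ∀ u v : Bool, u ≠ v → u = !v := by decide
  rcases key with hA | hA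
  · left
    refine ⟨hA, nb _ _ ?_⟩
    intro e
    refine h.nonconst hm (X 0) ?_
    intro i h0 h1
    rcases eq_or_lt_of_le h0 with rfl | h3
    · rfl
    · rw [hA i (by omega) h1, e]
  · right
    refine ⟨hA, nb _ _ ?_⟩
    intro e
    refine h.nonconst hm (X 0) ?_
    intro i h0 h1
    by_cases h3 : i = m - 1
    · rw [h3, e]
    · exact hA i h0 (by omega)

theorem occ_facts (x y t : List Bool) (ht : t.length = 3) (hx : ¬ x <:+: y)
    (h : x <:+: y ++ t ++ y) : ∃ d : ℤ, -2 ≤ d ∧ d ≤ (x.length : ℤ) - 1 ∧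
      (∀ j : ℤ, 0 ≤ j → j < 3 → 0 ≤ d + j → d + j < x.length →
        x.getD (d + j).toNat false = t.getD j.toNat false) ∧
      (∀ i : ℤ, 0 ≤ i → i < x.length → i < d →
        x.getD i.toNat false = y.getD (y.length - d + i).toNat false) ∧
      (∀ i : ℤ, 0 ≤ i → i < x.length → d + 3 ≤ i →
        x.getD i.toNat false = y.getD (i - d - 3).toNat false) := by
  obtain ⟨s, r, e⟩ := h
  have hlen := congrArg List.length e
  simp only [List.length_append, ht] at hlen
  have hget : ∀ i : ℕ, i < x.length → x[i]? = (y ++ t ++ y)[s.length + i]? := by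
    intro i hi
    rw [← e, List.append_assoc, List.getElem?_append_right (by omega),
      List.getElem?_append_left (by omega)]
    congr 1; omega
  refine ⟨(y.length : ℤ) - s.length, ?_, ?_, ?_, ?_, ?_⟩
  · by_contra hc
    apply hx
    have hs : s.length = (y ++ t).length + (s.length - (y ++ t).length) := by
      simp only [List.length_append, ht]; omega
    have e2 := congrArg (List.drop (y ++ t).length) e
    rw [List.drop_left, List.append_assoc, List.drop_append_of_le_length (by omega)] at e2
    exact ⟨_, r, by rw [List.append_assoc]; exact e2⟩
  · by_contra hc
    apply hx
    have e2 := congrArg (List.take y.length) e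
    rw [List.append_assoc y, List.take_left, List.take_append, List.take_of_length_le
      (by simp only [List.length_append]; omega)] at e2
    exact ⟨s, _, e2⟩
  · intro j h0 h1 h2 h3
    rw [List.getD_eq_getElem?_getD, List.getD_eq_getElem?_getD, hget _ (by omega),
      List.append_assoc, List.getElem?_append_right (by omega),
      List.getElem?_append_left (by omega)]
    congr 2; omega
  · intro i h0 h1 h2
    rw [List.getD_eq_getElem?_getD, List.getD_eq_getElem?_getD, hget _ (by omega),
      List.append_assoc, List.getElem?_append_left (by omega)]
    congr 2; omega
  · intro i h0 h1 h2
    rw [List.getD_eq_getElem?_getD, List.getD_eq_getElem?_getD, hget _ (by omega),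
      List.getElem?_append_right (by simp only [List.length_append]; omega)]
    congr 2; simp only [List.length_append]; omega

theorem memA_left (x : List Bool) (h2 : 2 ≤ x.length)
    (h : ∀ i : ℕ, 1 ≤ i → i < x.length → x.getD i false = !x.getD 0 false) : memA x := by
  have e : x = x.getD 0 false :: List.replicate (x.length - 1) (!x.getD 0 false) := by
    apply List.ext_getElem
    · simp; omega
    · intro i h1 h3
      rcases i with _ | i
      · simp [List.getD_eq_getElem?_getD, List.getElem?_eq_getElem h1]
      · have := h (i + 1) (by omega) h1
        rw [List.getD_eq_getElem?_getD, List.getElem?_eq_getElem h1] at this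
        simpa using this
  refine ⟨x.length - 1, by omega, ?_⟩
  generalize x.length - 1 = k at *
  cases hv : x.getD 0 false
  · rw [hv] at e; left; simpa using e
  · rw [hv] at e; right; left; simpa using e

theorem memA_right (x : List Bool) (h2 : 2 ≤ x.length)
    (h : ∀ i : ℕ, i + 1 < x.length → x.getD i false = x.getD 0 false)
    (hl : x.getD (x.length - 1) false = !x.getD 0 false) : memA x := by
  have e : x = List.replicate (x.length - 1) (x.getD 0 false) ++ [!x.getD 0 false] := by
    apply List.ext_getElem
    · simp; omega
    · intro i h1 h3
      by_cases hi : i + 1 < x.length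
      · have := h i hi
        rw [List.getD_eq_getElem?_getD, List.getElem?_eq_getElem h1] at this
        rw [List.getElem_append_left (by simp; omega)]
        simpa using this
      · have hi' : i = x.length - 1 := by omega
        rw [← hi', List.getD_eq_getElem?_getD, List.getElem?_eq_getElem h1] at hl
        rw [List.getElem_append_right (by simp; omega)]
        simpa using hl
  refine ⟨x.length - 1, by omega, ?_⟩
  generalize x.length - 1 = k at *
  cases hv : x.getD 0 false
  · rw [hv] at e; right; right; left; simpa using e
  · rw [hv] at e; right; right; right; simpa using e

theorem stmt_14 (x y : List Bool) (hA : ¬ memA x)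
    (hall : ∀ t : List Bool, t.length = 3 → x <:+: y ++ t ++ y) :
    x <:+: y := by
  by_contra hx
  have hm : 1 ≤ x.length := by
    rcases x with _ | ⟨u, x⟩
    · exact absurd (List.nil_infix) hx
    · simp
  have H : ∀ a b c : Bool, _ := fun a b c =>
    occ_facts x y [a, b, c] rfl hx (hall [a, b, c] rfl)
  choose D h1 h2 h3 h4 h5 using H
  have S : WSys (fun i => x.getD i.toNat false) x.length D := by
    refine ⟨h1, h2, ?_, ?_, ?_, ?_⟩
    · intro a b c p q
      simpa using h3 a b c 0 (by omega) (by omega) (by omega) (by omega)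
    · intro a b c p q
      simpa using h3 a b c 1 (by omega) (by omega) (by omega) (by omega)
    · intro a b c p q
      simpa using h3 a b c 2 (by omega) (by omega) (by omega) (by omega)
    · intro a b c a' b' c' i j g1 g2 g3 g4 g5
      rcases g5 with g5 | g5
      · have e1 := h4 a b c i g2 (by omega) g5
        have e2 := h4 a' b' c' j (by omega) g4 (by omega)
        simp only [e1, e2]
        congr 2; omega
      · have e1 := h5 a b c i g2 (by omega) g5
        have e2 := h5 a' b' c' j (by omega) g4 (by omega)
        simp only [e1, e2]
        congr 2; omega
  obtain ⟨m2, ⟨hL, hv⟩ | ⟨hR, hv⟩⟩ := S.main (by omega)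
  · refine hA (memA_left x (by omega) ?_)
    intro i hi hi'
    have := hL i (by omega) (by omega)
    have := this.trans hv
    simpa using this
  · refine hA (memA_right x (by omega) ?_ ?_)
    · intro i hi
      have := hR i (by omega) (by omega)
      simpa using this
    · have e : ((x.length : ℤ) - 1).toNat = x.length - 1 := by omega
      simp only [e] at hv
      simpa using hv
end

section
/- Let Σ = {0,1} and let x, y be words over Σ with y nonempty. Then x is a subword of every y-bordered word if and only if x is a subword of yty for every word t of length 3. -/
/-- `w` (restricted to `[0,m)`) occurs in `L t0 t1 t2 R` so that the block sits at index `q` of `w`. -/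
def Occ (w : ℤ → Bool) (m : ℤ) (L R : ℤ → Bool) (t0 t1 t2 : Bool) (q : ℤ) : Prop :=
  -2 ≤ q ∧ q < m ∧ ∀ j, 0 ≤ j → j < m →
    (j < q → w j = L (j - q)) ∧ (j = q → w j = t0) ∧ (j = q + 1 → w j = t1) ∧
    (j = q + 2 → w j = t2) ∧ (q + 3 ≤ j → w j = R (j - q))

def AllOcc (w : ℤ → Bool) (m : ℤ) (L R : ℤ → Bool) : Prop :=
  ∀ t0 t1 t2, ∃ q, Occ w m L R t0 t1 t2 q

def AF (w : ℤ → Bool) (m : ℤ) : Prop :=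
  ((∀ j, 0 ≤ j → j < m - 1 → w j = w 0) ∧ w (m-1) ≠ w 0) ∨
  ((∀ j, 1 ≤ j → j < m → w j = w (m-1)) ∧ w 0 ≠ w (m-1))

lemma Occ.pair {w m L R t0 t1 t2 q s0 s1 s2 r} (h : Occ w m L R t0 t1 t2 q)
    (h' : Occ w m L R s0 s1 s2 r) (hqr : q < r) (j j' : ℤ) (hj : 0 ≤ j) (hj' : j' < m)
    (hd : j' - j = r - q) (e0 : j ≠ q ∨ t0 = s0) (e1 : j ≠ q + 1 ∨ t1 = s1)
    (e2 : j ≠ q + 2 ∨ t2 = s2) : w j = w j' := by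
  obtain ⟨a0, a1, a2, a3, a4⟩ := h.2.2 j hj (by omega)
  obtain ⟨b0, b1, b2, b3, b4⟩ := h'.2.2 j' (by omega) hj'
  have hh : j' - r = j - q := by omega
  rw [hh] at b0 b4
  by_cases c0 : j < q
  · rw [a0 c0, b0 (by omega)]
  by_cases c1 : j = q
  · rw [a1 c1, b1 (by omega)]; exact e0.resolve_left (fun hne => hne c1)
  by_cases c2 : j = q + 1
  · rw [a2 c2, b2 (by omega)]; exact e1.resolve_left (fun hne => hne c2)
  by_cases c3 : j = q + 2
  · rw [a3 c3, b3 (by omega)]; exact e2.resolve_left (fun hne => hne c3)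
  rw [a4 (by omega), b4 (by omega)]

lemma Occ.e0 {w m L R t0 t1 t2 q} (h : Occ w m L R t0 t1 t2 q) (hq : 0 ≤ q) : w q = t0 :=
  (h.2.2 q hq h.2.1).2.1 rfl
lemma Occ.e1 {w m L R t0 t1 t2 q} (h : Occ w m L R t0 t1 t2 q) (hq : 0 ≤ q + 1) (hm : q + 1 < m) :
    w (q+1) = t1 := (h.2.2 (q+1) hq hm).2.2.1 rfl
lemma Occ.e2 {w m L R t0 t1 t2 q} (h : Occ w m L R t0 t1 t2 q) (hq : 0 ≤ q + 2) (hm : q + 2 < m) :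
    w (q+2) = t2 := (h.2.2 (q+2) hq hm).2.2.2.1 rfl

lemma triple0 {w m L R a0 a1 b0 b1 c0 c1 q1 q2 q3 z} (h1 : Occ w m L R a0 a1 z q1)
    (h2 : Occ w m L R b0 b1 z q2) (h3 : Occ w m L R c0 c1 z q3) (h12 : q1 < q2) (h23 : q2 < q3)
    (hq : 0 ≤ q1) (hne : a0 ≠ c0) (hd : q3 - q2 ≠ 1 ∨ a1 = b1) : False := by
  have hm := h3.2.1
  have e1 := h2.pair h3 h23 q1 (q1 + (q3 - q2)) hq (by omega) (by omega)
    (by left; omega) (by left; omega) (by left; omega)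
  have e2 := h1.pair h2 h12 (q1 + (q3 - q2)) q3 (by omega) (by omega) (by omega)
    (by left; omega) (by rcases hd with h | h; left; omega; right; exact h) (by right; rfl)
  exact hne (by rw [← h1.e0 hq, ← h3.e0 (by omega), e1, e2])

lemma triple1 {w m L R a0 a1 b0 b1 c0 c1 q1 q2 q3 z} (h1 : Occ w m L R a0 a1 z q1)
    (h2 : Occ w m L R b0 b1 z q2) (h3 : Occ w m L R c0 c1 z q3) (h12 : q1 < q2) (h23 : q2 < q3)
    (hq : 0 ≤ q1) (hm : q3 + 1 < m) (hne : a1 ≠ c1) (hd : q2 - q1 ≠ 1 ∨ b0 = c0) : False := by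
  have e1 := h2.pair h3 h23 (q1+1) (q1 + 1 + (q3 - q2)) (by omega) (by omega) (by omega)
    (by rcases hd with h | h; left; omega; right; exact h) (by left; omega) (by left; omega)
  have e2 := h1.pair h2 h12 (q1 + 1 + (q3 - q2)) (q3+1) (by omega) (by omega) (by omega)
    (by left; omega) (by left; omega) (by right; rfl)
  exact hne (by rw [← h1.e1 (by omega) (by omega), ← h3.e1 (by omega) hm, e1, e2])

/-- two adjacent blocks force the shape `0^(q+1) * 1^(m-q-2)`. -/
lemma adj {w m L R a0 a1 b0 b1 q r} (h1 : Occ w m L R a0 a1 true q)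
    (h2 : Occ w m L R b0 b1 true r) (hr : r = q + 1) (hq : 0 ≤ q) (hm : r + 1 < m) :
    (∀ j, 0 ≤ j → j ≤ q → w j = w 0) ∧ (∀ j, q + 2 ≤ j → j < m → w j = true) := by
  have hqr : q < r := by omega
  constructor
  · intro j hj
    induction j, hj using Int.leInduction with
    | base => intro _; rfl
    | succ n hn ih =>
      intro h
      rw [← ih (by omega)]
      exact (h1.pair h2 hqr n (n+1) hn (by omega) (by omega) (by left; omega) (by left; omega)
        (by left; omega)).symm
  · intro j hj
    induction j, hj using Int.leInduction with
    | base => intro _; exact h1.e2 (by omega) (by omega)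
    | succ n hn ih =>
      intro h
      rw [← ih (by omega)]
      exact (h1.pair h2 hqr n (n+1) (by omega) (by omega) (by omega) (by left; omega) (by left; omega)
        (by right; rfl)).symm

lemma ne_true_of {a b : Bool} (h : a ≠ b) : a = !b := by cases a <;> cases b <;> simp_all

/-- shape contradiction -/
lemma adjK {w m L R a0 a1 b0 b1 q r C c e} (hm3 : 3 ≤ m) (w0 : w 0 = false) (wc : w (m-1) = c)
    (hA : ¬ AF w m)
    (h1 : Occ w m L R a0 a1 true q)
    (h2 : Occ w m L R b0 b1 true r) (hr : r = q + 1) (hq : 0 ≤ q) (hm : r + 1 < m)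
    (hC : Occ w m L R c e true C) (C0 : 0 ≤ C) (Cm : C + 1 < m) (he : w 1 = true ∨ e = false) :
    False := by
  obtain ⟨s1, s2⟩ := adj h1 h2 hr hq hm
  have : c = true := by rw [← wc]; exact s2 _ (by omega) (by omega)
  subst this
  rcases he with he | he
  · apply hA
    right
    refine ⟨?_, by rw [w0, wc]; simp⟩
    intro j hj hjm
    rw [wc]
    have : q = 0 := by
      by_contra hne
      have := s1 1 (by omega) (by omega)
      rw [he, w0] at this; simp at this
    subst this
    by_cases hj1 : j = 1
    · rw [hj1, he]
    · exact s2 j (by omega) hjm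
  · subst he
    have c0 := hC.e0 C0
    have c1 := hC.e1 (by omega) Cm
    by_cases h : C ≤ q
    · have := s1 C C0 h
      rw [c0, w0] at this; simp at this
    · have := s2 (C+1) (by omega) Cm
      rw [c1] at this; simp at this

/-- Case where the block (c,e,1) sits at the last letter. -/
lemma lastK {w m L R a1 b1 A B c e} (wc : w (m-1) = c)
    (hA : ¬ AF w m)
    (h1 : Occ w m L R (!c) a1 true A) (h2 : Occ w m L R (!c) b1 true B) 
    (hC : Occ w m L R c e true (m-1)) (h12 : A < B) (A0 : 0 ≤ A) (Bm : B < m - 1) : False := by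
  by_cases hB : B = m - 2
  · apply hA
    left
    have key : ∀ j, 0 ≤ j → j < m - 1 → w j = w 0 := by
      intro j hj
      induction j, hj using Int.leInduction with
      | base => intro _; rfl
      | succ n hn ih =>
        intro h
        rw [← ih (by omega)]
        exact (h2.pair hC Bm n (n+1) (by omega) (by omega) (by omega) (by left; omega)
          (by left; omega) (by right; rfl)).symm
    refine ⟨key, ?_⟩
    rw [← key B (by omega) (by omega), wc, h2.e0 (by omega)]
    cases c <;> simp
  · exact triple0 h1 h2 hC h12 Bm A0 (by cases c <;> simp) (by left; omega)

lemma coreK {w m L R A B C c e} (hm3 : 3 ≤ m) (w0 : w 0 = false) (wc : w (m-1) = c)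
    (hA : ¬ AF w m)
    (h1 : Occ w m L R (!c) false true A) (h2 : Occ w m L R (!c) true true B)
    (hC : Occ w m L R c e true C) (A0 : 0 ≤ A) (B0 : 0 ≤ B) (C0 : 0 ≤ C)
    (he : w 1 = true ∨ e = false) : False := by
  have last : ∀ {x q}, Occ w m L R (!c) x true q → 0 ≤ q → q < m - 1 := by
    intro x q h h0
    by_contra hh
    have hq := h.2.1
    have : q = m - 1 := by omega
    have h3 := h.e0 h0
    rw [this, wc] at h3
    cases c <;> simp at h3
  have Am := last h1 A0
  have Bm := last h2 B0
  have hAB : A ≠ B := by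
    rintro rfl
    have := h1.e1 (by omega) (by omega)
    rw [h2.e1 (by omega) (by omega)] at this; simp at this
  have Cm' := hC.2.1
  by_cases Cl : C = m - 1
  · subst Cl
    rcases lt_or_gt_of_ne hAB with h | h
    · exact lastK wc hA h1 h2 hC h A0 Bm
    · exact lastK wc hA h2 h1 hC h B0 Am
  have Cm : C + 1 < m := by omega
  have hcc : (!c) ≠ c := by cases c <;> simp
  have nAC : A ≠ C := by
    rintro rfl
    exact hcc ((h1.e0 A0).symm.trans (hC.e0 A0))
  have nBC : B ≠ C := by
    rintro rfl
    exact hcc ((h2.e0 B0).symm.trans (hC.e0 B0))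
  have nadj : ∀ {a0 a1 b0 b1 q r}, Occ w m L R a0 a1 true q → Occ w m L R b0 b1 true r →
      0 ≤ q → r < m - 1 → r ≠ q + 1 := fun h h' hq hr hh =>
    adjK hm3 w0 wc hA h h' hh hq (by omega) hC C0 Cm he
  have x1 := nadj h1 h2 A0 Bm
  have x2 := nadj h2 h1 B0 Am
  have x3 := nadj h1 hC A0 (by omega)
  have x4 := nadj hC h1 C0 Am
  have x5 := nadj h2 hC B0 (by omega)
  have x6 := nadj hC h2 C0 Bm
  rcases lt_or_gt_of_ne hAB with a | a <;> rcases lt_or_gt_of_ne nAC with b | b <;>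
    rcases lt_or_gt_of_ne nBC with d | d
  · exact triple0 h1 h2 hC a d A0 hcc (by left; omega)
  · exact triple1 h1 hC h2 b d A0 (by omega) (by simp) (by left; omega)
  · omega
  · exact triple0 hC h1 h2 b a C0 hcc.symm (by left; omega)
  · exact triple0 h2 h1 hC a b B0 hcc (by left; omega)
  · omega
  · exact triple1 h2 hC h1 d b B0 (by omega) (by simp) (by left; omega)
  · exact triple0 hC h2 h1 d a C0 hcc.symm (by left; omega)

lemma AllOcc.compl {w m L R} (h : AllOcc w m L R) :
    AllOcc (fun j => !w j) m (fun j => !L j) (fun j => !R j) := by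
  intro t0 t1 t2
  obtain ⟨q, a, b, hq⟩ := h (!t0) (!t1) (!t2)
  refine ⟨q, a, b, fun j h0 h1 => ?_⟩
  obtain ⟨a0, a1, a2, a3, a4⟩ := hq j h0 h1
  refine ⟨fun h => ?_, fun h => ?_, fun h => ?_, fun h => ?_, fun h => ?_⟩
  · simp [a0 h]
  · simp [a1 h]
  · simp [a2 h]
  · simp [a3 h]
  · simp [a4 h]

lemma Occ.rev {w m L R t0 t1 t2 q} (h : Occ w m L R t0 t1 t2 q) :
    Occ (fun j => w (m-1-j)) m (fun j => R (2-j)) (fun j => L (2-j)) t2 t1 t0 (m-3-q) := by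
  obtain ⟨a, b, hq⟩ := h
  refine ⟨by omega, by omega, fun j h0 h1 => ?_⟩
  obtain ⟨a0, a1, a2, a3, a4⟩ := hq (m-1-j) (by omega) (by omega)
  refine ⟨fun h => ?_, fun h => ?_, fun h => ?_, fun h => ?_, fun h => ?_⟩
  · show w (m-1-j) = R _
    rw [a4 (by omega)]; congr 1; omega
  · exact a3 (by omega)
  · exact a2 (by omega)
  · exact a1 (by omega)
  · show w (m-1-j) = L _
    rw [a0 (by omega)]; congr 1; omega

lemma Occ.compl {w m L R t0 t1 t2 q} (h : Occ w m L R t0 t1 t2 q) :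
    Occ (fun j => !w j) m (fun j => !L j) (fun j => !R j) (!t0) (!t1) (!t2) q := by
  obtain ⟨a, b, hq⟩ := h
  refine ⟨a, b, fun j h0 h1 => ?_⟩
  obtain ⟨a0, a1, a2, a3, a4⟩ := hq j h0 h1
  refine ⟨fun h => ?_, fun h => ?_, fun h => ?_, fun h => ?_, fun h => ?_⟩
  · simp [a0 h]
  · simp [a1 h]
  · simp [a2 h]
  · simp [a3 h]
  · simp [a4 h]

lemma AllOcc.rev {w m L R} (h : AllOcc w m L R) :
    AllOcc (fun j => w (m-1-j)) m (fun j => R (2-j)) (fun j => L (2-j)) := by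
  intro t0 t1 t2
  obtain ⟨q, hq⟩ := h t2 t1 t0
  exact ⟨_, hq.rev⟩

lemma AF.compl {w m} (h : AF (fun j => !w j) m) : AF w m := by
  unfold AF at *
  simpa using h

lemma AF.rev {w m} (h : AF (fun j => w (m-1-j)) m) : AF w m := by
  unfold AF at *
  simp only [sub_self, sub_zero] at h
  rcases h with ⟨h, h'⟩ | ⟨h, h'⟩
  · right
    refine ⟨fun j hj hjm => ?_, by simpa using h'⟩
    have := h (m-1-j) (by omega) (by omega)
    simpa using this
  · left
    refine ⟨fun j hj hjm => ?_, by simpa using h'⟩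
    have := h (m-1-j) (by omega) (by omega)
    simpa using this

/-- case 00... -/
lemma case00 {w m L R} (h : AllOcc w m L R) (hm3 : 3 ≤ m) (w0 : w 0 = false) (w1 : w 1 = false) :
    AF w m := by
  by_contra hA
  have nn : ∀ {t0 t1 q}, Occ w m L R t0 t1 true q → 0 ≤ q := by
    intro t0 t1 q hq
    by_contra hneg
    have := hq.1
    have h2 := hq.e2 (by omega) (by omega)
    have : q = -2 ∨ q = -1 := by omega
    rcases this with rfl | rfl
    · norm_num [w0] at h2
    · norm_num [w1] at h2
  obtain ⟨A, h1⟩ := h (!w (m-1)) false true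
  obtain ⟨B, h2⟩ := h (!w (m-1)) true true
  obtain ⟨C, h3⟩ := h (w (m-1)) false true
  exact coreK hm3 w0 rfl hA h1 h2 h3 (nn h1) (nn h2) (nn h3) (Or.inr rfl)

lemma case_eq {w m L R} (h : AllOcc w m L R) (hm3 : 3 ≤ m) (w01 : w 0 = w 1) : AF w m := by
  cases w0 : w 0
  · exact case00 h hm3 w0 (w01.symm.trans w0)
  · exact AF.compl (case00 h.compl hm3 (by simp [w0]) (by simp [← w01, w0]))

lemma case_eq' {w m L R} (h : AllOcc w m L R) (hm3 : 3 ≤ m) (w01 : w (m-1) = w (m-2)) : AF w m := by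
  refine AF.rev (case_eq h.rev hm3 ?_)
  simp only [sub_zero]
  rw [w01]; congr 1; omega

/-- half of the cases 01... -/
lemma half01 {w m L R A c} (h : AllOcc w m L R) (hm3 : 3 ≤ m) (w0 : w 0 = false) (w1 : w 1 = true)
    (wc : w (m-1) = c) (h1 : Occ w m L R (!c) false true A) (A0 : 0 ≤ A) : AF w m := by
  by_contra hA
  have nn : ∀ {t0 q}, Occ w m L R t0 true true q → 0 ≤ q := by
    intro t0 q hq
    by_contra hneg
    have := hq.1
    have : q = -2 ∨ q = -1 := by omega
    rcases this with rfl | rfl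
    · have h2 := hq.e2 (by omega) (by omega)
      norm_num [w0] at h2
    · have h2 := hq.e1 (by omega) (by omega)
      norm_num [w0] at h2
  obtain ⟨B, h2⟩ := h (!c) true true
  obtain ⟨C, h3⟩ := h c true true
  exact coreK hm3 w0 wc hA h1 h2 h3 A0 (nn h2) (nn h3) (Or.inl w1)

lemma case0110 {w m L R} (h : AllOcc w m L R) (hm3 : 3 ≤ m) (w0 : w 0 = false) (w1 : w 1 = true)
    (wc : w (m-1) = false) (wd : w (m-2) = true) : AF w m := by
  obtain ⟨A, h1⟩ := h true false true
  by_cases A0 : 0 ≤ A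
  · exact half01 h hm3 w0 w1 wc h1 A0
  · refine AF.rev (half01 (c := false) h.rev hm3 (by simpa using wc) ?_ (by simpa using w0)
      h1.rev (by omega))
    rw [← wd]; congr 1; omega

lemma case0101 {w m L R} (h : AllOcc w m L R) (hm3 : 3 ≤ m) (w0 : w 0 = false) (w1 : w 1 = true)
    (wc : w (m-1) = true) (wd : w (m-2) = false) : AF w m := by
  obtain ⟨A, h1⟩ := h false false true
  by_cases A0 : 0 ≤ A
  · exact half01 h hm3 w0 w1 wc h1 A0
  obtain ⟨B, h2⟩ := h false true true
  by_cases B0 : B ≤ m - 3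
  · refine AF.rev (AF.compl (half01 (c := true) h.rev.compl hm3 (by simpa using wc) ?_
      (by simpa using w0) h2.rev.compl (by omega)))
    have : m - 1 - 1 = m - 2 := by omega
    simp [this, wd]
  by_contra hA
  have hA1 : A = -1 := by
    have := h1.1
    by_contra hne
    have : A = -2 := by omega
    subst this
    have := h1.e2 (by omega) (by omega)
    norm_num [w0] at this
  have hB : B = m - 2 := by
    have := h2.2.1
    by_contra hne
    have : B = m - 1 := by omega
    subst this
    have := h2.e0 (by omega)
    rw [wc] at this; simp at this
  subst hA1 hB
  obtain ⟨C, h3⟩ := h true true true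
  have C0 : 0 < C := by
    have := h3.1
    by_contra hneg
    have : C = -2 ∨ C = -1 ∨ C = 0 := by omega
    rcases this with rfl | rfl | rfl
    · have h2 := h3.e2 (by omega) (by omega)
      norm_num [w0] at h2
    · have h2 := h3.e1 (by omega) (by omega)
      norm_num [w0] at h2
    · have h2 := h3.e0 (by omega)
      norm_num [w0] at h2
  have hCm := h3.2.1
  have C2 : C ≠ m - 2 := by
    rintro rfl
    have := h3.e0 (by omega)
    rw [wd] at this; simp at this
  by_cases C1 : C = m - 1
  · apply hA
    left
    have key : ∀ j, 0 ≤ j → j < m - 1 → w j = w 0 := by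
      intro j hj
      induction j, hj using Int.leInduction with
      | base => intro _; rfl
      | succ n hn ih =>
        intro hh
        rw [← ih (by omega)]
        exact (h2.pair h3 (by omega) n (n+1) (by omega) (by omega) (by omega) (by left; omega)
          (by right; rfl) (by right; rfl)).symm
    exact ⟨key, by rw [w0, wc]; simp⟩
  · have e1 := h3.pair h2 (by omega) 0 (m-2-C) (by omega) (by omega) (by omega) (by left; omega)
      (by right; rfl) (by right; rfl)
    have e2 := h1.pair h3 (by omega) (m-2-C) (m-1) (by omega) (by omega) (by omega) (by left; omega)
      (by left; omega) (by right; rfl)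
    rw [← e1, w0, wc] at e2
    simp at e2

lemma case01 {w m L R} (h : AllOcc w m L R) (hm3 : 3 ≤ m) (w0 : w 0 = false) (w1 : w 1 = true) :
    AF w m := by
  cases wc : w (m-1) <;> cases wd : w (m-2)
  · exact case_eq' h hm3 (by rw [wc, wd])
  · exact case0110 h hm3 w0 w1 wc wd
  · exact case0101 h hm3 w0 w1 wc wd
  · exact case_eq' h hm3 (by rw [wc, wd])

lemma main_core {w m L R} (h : AllOcc w m L R) (hm : 1 ≤ m) : AF w m := by
  by_cases hm3 : 3 ≤ m
  · cases w0 : w 0 <;> cases w1 : w 1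
    · exact case_eq h hm3 (by rw [w0, w1])
    · exact case01 h hm3 w0 w1
    · exact AF.compl (case01 h.compl hm3 (by simp [w0]) (by simp [w1]))
    · exact case_eq h hm3 (by rw [w0, w1])
  have : m = 1 ∨ m = 2 := by omega
  obtain ⟨q, hq⟩ := h (!w 0) (!w 0) (!w 0)
  have q1 := hq.1
  have q2 := hq.2.1
  have blk : ∀ j, 0 ≤ j → j < m → q ≤ j → j ≤ q + 2 → w j = !w 0 := by
    intro j a b c d
    obtain ⟨-, a1, a2, a3, -⟩ := hq.2.2 j a b
    have : j = q ∨ j = q + 1 ∨ j = q + 2 := by omega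
    tauto
  rcases this with rfl | rfl
  · have := blk 0 (by omega) (by omega) (by omega) (by omega)
    simp at this
  · have w1 : w 1 ≠ w 0 := by
      intro h10
      by_cases hq1 : q ≤ 0
      · have := blk 0 (by omega) (by omega) (by omega) (by omega)
        simp at this
      · have := blk 1 (by omega) (by omega) (by omega) (by omega)
        simp [h10] at this
    left
    refine ⟨fun j a b => ?_, by simpa using w1⟩
    have : j = 0 := by omega
    rw [this]

lemma occ_of_infix {x y : List Bool} {t0 t1 t2 : Bool} (hx : ¬ x <:+: y)
    (h : x <:+: y ++ [t0, t1, t2] ++ y) :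
    ∃ q, Occ (fun j => x.getD j.toNat false) x.length
      (fun i => y.getD ((y.length : ℤ) + i).toNat false) (fun i => y.getD (i - 3).toNat false)
      t0 t1 t2 q := by
  obtain ⟨u, v, huv⟩ := h
  have hlen := congrArg List.length huv
  simp only [List.length_append, List.length_cons, List.length_nil] at hlen
  have h1 : y.length < u.length + x.length := by
    by_contra hle
    apply hx
    have p1 : u ++ x <+: y ++ [t0, t1, t2] ++ y := ⟨v, huv⟩
    have p2 : y <+: y ++ [t0, t1, t2] ++ y := ⟨[t0, t1, t2] ++ y, by simp⟩
    have p3 := List.prefix_of_prefix_length_le p1 p2 (by simp; omega)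
    exact List.IsInfix.trans ⟨u, [], by simp⟩ p3.isInfix
  have h2 : u.length < y.length + 3 := by
    by_contra hle
    apply hx
    have p1 : x ++ v <:+ y ++ [t0, t1, t2] ++ y := ⟨u, by rw [← huv]; simp⟩
    have p2 : y <:+ y ++ [t0, t1, t2] ++ y := ⟨y ++ [t0, t1, t2], by simp⟩
    have p3 := List.suffix_of_suffix_length_le p1 p2 (by simp; omega)
    exact List.IsInfix.trans ⟨[], v, by simp⟩ p3.isInfix
  refine ⟨(y.length : ℤ) - u.length, by omega, by omega, ?_⟩
  intro j hj0 hjm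
  lift j to ℕ using hj0
  have hj : j < x.length := by omega
  have key : x[j]? = (y ++ [t0, t1, t2] ++ y)[u.length + j]? := by
    rw [← huv, List.append_assoc, List.getElem?_append_right (by omega),
      List.getElem?_append_left (by omega)]
    congr 1; omega
  simp only [List.getD_eq_getElem?_getD, Int.toNat_natCast]
  rw [key]
  refine ⟨fun h => ?_, fun h => ?_, fun h => ?_, fun h => ?_, fun h => ?_⟩
  · rw [List.append_assoc, List.getElem?_append_left (by omega)]
    congr 2; omega
  · have : u.length + j = y.length := by omega
    simp [this]
  · have : u.length + j = y.length + 1 := by omega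
    simp [this]
  · have : u.length + j = y.length + 2 := by omega
    simp [this]
  · rw [List.getElem?_append_right (by simp; omega)]
    congr 2
    simp; omega

lemma runs {d : Bool} {i : ℕ} : ∀ (v u : List Bool), (!d) ∈ v →
    List.replicate i d ++ [!d] <:+: u ++ List.replicate i d ++ v := by
  intro v
  induction v with
  | nil => intro u h; simp at h
  | cons e v ih =>
    intro u h
    by_cases he : e = d
    · subst he
      have h' : (!e) ∈ v := by
        rcases List.mem_cons.1 h with h | h
        · cases e <;> simp at h
        · exact h
      have h2 := ih (u ++ [e]) h'
      have h3 : [e] ++ List.replicate i e = List.replicate i e ++ [e] := by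
        rw [← List.replicate_succ', List.replicate_succ]; rfl
      have h4 : u ++ List.replicate i e ++ e :: v = u ++ [e] ++ List.replicate i e ++ v := by
        rw [List.append_assoc u [e], h3]; simp
      rw [h4]; exact h2
    · have : e = !d := ne_true_of he
      subst this
      exact ⟨u, v, by simp⟩

lemma repl_prefix {d : Bool} : ∀ (i : ℕ) (a b : List Bool),
    List.replicate i d <+: a ++ (!d) :: b → List.replicate i d <+: a := by
  intro i
  induction i with
  | zero => intro a b _; simp
  | succ i ih =>
    intro a b h
    cases a with
    | nil =>
      rw [List.replicate_succ, List.nil_append, List.cons_prefix_cons] at h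
      cases d <;> simp at h
    | cons e a =>
      rw [List.replicate_succ, List.cons_append, List.cons_prefix_cons] at h
      rw [List.replicate_succ, List.cons_prefix_cons]
      exact ⟨h.1, ih _ _ h.2⟩

lemma repl_infix {d : Bool} {i : ℕ} (hi : 1 ≤ i) : ∀ (a b : List Bool),
    List.replicate i d <:+: a ++ (!d) :: b →
      List.replicate i d <:+: a ∨ List.replicate i d <:+: b := by
  intro a
  induction a with
  | nil =>
    intro b h
    rw [List.nil_append, List.infix_cons_iff] at h
    rcases h with h | h
    · have := repl_prefix i [] b h
      exact Or.inl this.isInfix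
    · exact Or.inr h
  | cons e a ih =>
    intro b h
    rw [List.cons_append, List.infix_cons_iff] at h
    rcases h with h | h
    · exact Or.inl (repl_prefix i (e :: a) b h).isInfix
    · rcases ih b h with h | h
      · exact Or.inl (List.infix_cons_iff.2 (Or.inr h))
      · exact Or.inr h

lemma caseA {d : Bool} {i : ℕ} (hi : 1 ≤ i) {y : List Bool}
    (H : ∀ t : List Bool, t.length = 3 → List.replicate i d ++ [!d] <:+: y ++ t ++ y)
    {z : List Bool} (hz : IsBordered y z) : List.replicate i d ++ [!d] <:+: z := by
  obtain ⟨hne, ⟨s, hs⟩, ⟨s', hs'⟩⟩ := hz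
  have hyz : y <:+: z := ⟨[], s, by simpa using hs⟩
  have hcy : (!d) ∈ y := by
    have h1 := (H [d, d, d] rfl).subset (show (!d) ∈ List.replicate i d ++ [!d] by simp)
    simpa using h1
  have hdy : List.replicate i d <:+: y := by
    have h1 : List.replicate i d <:+: y ++ [!d, !d, !d] ++ y :=
      List.IsInfix.trans ⟨[], [!d], by simp⟩ (H [!d, !d, !d] rfl)
    rw [List.append_assoc] at h1
    rcases repl_infix hi y _ h1 with h | h
    · exact h
    rcases repl_infix hi [] _ h with h | h
    · exact h.trans ⟨[], y, by simp⟩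
    rcases repl_infix hi [] _ h with h | h
    · exact h.trans ⟨[], y, by simp⟩
    · exact h
  obtain ⟨u, v, huv⟩ := hdy
  have hcd : (!d) ∉ List.replicate i d := by
    rw [List.mem_replicate]; cases d <;> simp
  have hc : (!d) ∈ u ∨ (!d) ∈ v := by
    rw [← huv] at hcy
    simp only [List.mem_append] at hcy
    tauto
  rcases hc with hc | hc
  swap
  · refine List.IsInfix.trans ?_ hyz
    rw [← huv]; exact runs v u hc
  have hs'1 : s' ≠ [] := by
    rintro rfl
    exact hne (by simpa using hs'.symm)
  have h1 : z = u ++ List.replicate i d ++ (v ++ s) := by rw [← hs, ← huv]; simp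
  rw [h1]
  apply runs
  -- the last occurrence of the other letter in `u`
  obtain ⟨p, r, hpr, hr⟩ : ∃ p r, u = p ++ (!d) :: r ∧ (!d) ∉ r := by
    obtain ⟨p, r, h, hr⟩ := List.eq_append_cons_of_mem (List.mem_reverse.2 hc)
    refine ⟨r.reverse, p.reverse, ?_, by simpa using hr⟩
    rw [← List.reverse_reverse u, h]; simp
  have h2 : p ++ ([!d] ++ (r ++ List.replicate i d ++ (v ++ s))) =
      (s' ++ p) ++ ((!d) :: (r ++ List.replicate i d ++ v)) := by
    have : s' ++ y = y ++ s := by rw [hs, hs']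
    rw [← huv, hpr] at this
    simpa using this.symm
  have h3 := congrArg (List.drop (p.length + 1)) h2
  have hl : 1 ≤ s'.length := List.length_pos_iff.2 hs'1
  rw [← List.append_assoc, List.drop_append_of_le_length (l₁ := p ++ [!d]) (by simp),
    List.drop_append_of_le_length (l₁ := s' ++ p) (by simp; omega)] at h3
  have h4 : (!d) ∈ r ++ List.replicate i d ++ (v ++ s) := by
    have : List.drop (p.length + 1) (p ++ [!d]) = [] := by simp
    rw [this, List.nil_append] at h3
    rw [h3]; simp
  simp only [List.mem_append] at h4 ⊢
  tauto

lemma caseA' {d : Bool} {i : ℕ} (hi : 1 ≤ i) {y : List Bool}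
    (H : ∀ t : List Bool, t.length = 3 → (!d) :: List.replicate i d <:+: y ++ t ++ y)
    {z : List Bool} (hz : IsBordered y z) : (!d) :: List.replicate i d <:+: z := by
  have hr : ((!d) :: List.replicate i d).reverse = List.replicate i d ++ [!d] := by simp
  rw [← List.reverse_infix, hr]
  refine caseA hi (y := y.reverse) ?_ ⟨?_, ?_, ?_⟩
  · intro t ht
    have := H t.reverse (by simpa using ht)
    rw [← List.reverse_infix, hr] at this
    simpa using this
  · intro h; exact hz.1 (List.reverse_injective h)
  · rw [List.reverse_prefix]; exact hz.2.2
  · rw [List.reverse_suffix]; exact hz.2.1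

theorem stmt_15 (x y : List Bool) (hy : y ≠ []) :
    (∀ z : List Bool, IsBordered y z → x <:+: z) ↔
      (∀ t : List Bool, t.length = 3 → x <:+: y ++ t ++ y) := by
  constructor
  · intro h t ht
    refine h _ ⟨?_, ⟨t ++ y, by simp⟩, ⟨y ++ t, by simp⟩⟩
    intro he
    have := congrArg List.length he
    simp only [List.length_append] at this; omega
  intro H z hz
  by_cases hx : x <:+: y
  · exact hx.trans hz.2.1.isInfix
  have hx0 : x ≠ [] := by
    rintro rfl; exact hx (List.nil_infix)
  have hm : 1 ≤ x.length := List.length_pos_iff.2 hx0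
  have hAF := main_core (fun t0 t1 t2 => occ_of_infix hx (H [t0, t1, t2] rfl)) (by omega)
  rcases hAF with ⟨h1, h2⟩ | ⟨h1, h2⟩
  · have hm2 : 2 ≤ x.length := by
      by_contra hlt
      have : x.length = 1 := by omega
      simp [this] at h2
    have e : x = List.replicate (x.length - 1) (x.getD 0 false) ++ [!(x.getD 0 false)] := by
      apply List.ext_getElem
      · simp; omega
      · intro j a b
        by_cases hj : j < x.length - 1
        · have := h1 j (by omega) (by omega)
          rw [List.getElem_append_left (by simpa using hj)]
          simp only [List.getElem_replicate]
          simpa only [Int.toNat_natCast, Int.toNat_zero, List.getD_eq_getElem _ _ a] using this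
        · have hj' : j = x.length - 1 := by omega
          rw [List.getElem_append_right (by simp; omega)]
          have h3 := ne_true_of h2
          have h4 : ((x.length : ℤ) - 1).toNat = j := by omega
          simp only [h4, List.getD_eq_getElem _ _ a] at h3
          simpa using h3
    rw [e] at H ⊢
    exact caseA (by omega) H hz
  · have hm2 : 2 ≤ x.length := by
      by_contra hlt
      have : x.length = 1 := by omega
      simp [this] at h2
    have e : x = (!(x.getD (x.length - 1) false)) ::
        List.replicate (x.length - 1) (x.getD (x.length - 1) false) := by
      have h4 : ((x.length : ℤ) - 1).toNat = x.length - 1 := by omega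
      simp only [h4] at h1 h2
      apply List.ext_getElem
      · simp; omega
      · intro j a b
        by_cases hj : j = 0
        · subst hj
          have h3 := ne_true_of h2
          simpa only [Int.toNat_zero, List.getD_eq_getElem _ _ a, List.getElem_cons_zero] using h3
        · obtain ⟨k, rfl⟩ := Nat.exists_eq_succ_of_ne_zero hj
          have := h1 (k+1 : ℕ) (by omega) (by omega)
          simpa only [Int.toNat_natCast, List.getD_eq_getElem _ _ a, List.getElem_cons_succ,
            List.getElem_replicate] using this
    rw [e] at H ⊢
    exact caseA' (by omega) H hz
end
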